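/- Let j, m ≥ 0 with j + m ≥ 1 and let Φ : ℝ^{j+m} → ℂ be a Schwartz function whose support is contained in K_0 × ℝ^m for some compact set K_0 ⊂ (0,∞)^j. For λ ∈ ℂ^{j+m} with Re(λ_i) > 0 for i = j+1, …, j+m, define Φ̃(λ) = ∫_{(0,∞)^{j+m}} Φ(x) ∏_{i=1}^{j+m} x_i^{λ_i − 1} dx. Then Φ̃ is well defined (the integral converging absolutely) and holomorphic in each variable on the stated domain, and for every compact set K ⊂ ℝ^j × (0,∞)^m, every multi-index α of nonnegative integers, and every nonnegative integer n, there is C > 0 such that (‖λ‖ + 1)^n · |∂^α Φ̃(λ)| ≤ C for all λ with (Re(λ_1), …, Re(λ_{j+m})) ∈ K, where ∂^α Φ̃(λ) = ∫_{(0,∞)^{j+m}} Φ(x) ∏_i (log x_i)^{α_i} x_i^{λ_i−1} dx and ‖λ‖ is the Euclidean norm on ℂ^{j+m}. -/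

import Mathlib

open MeasureTheory Complex

/-- The Euclidean norm `‖λ‖ = √(∑ |λᵢ|²)` on `ℂ^N`. -/
noncomputable def euclideanNormC {N : ℕ} (l : Fin N → ℂ) : ℝ :=
  Real.sqrt (∑ i, ‖l i‖ ^ 2)

namespace MellinAux

/-- Coordinatewise exponential. -/
noncomputable def mE {N : ℕ} (t : Fin N → ℝ) : Fin N → ℝ := fun i => Real.exp (t i)

/-- The kernel in logarithmic coordinates. -/
noncomputable def mG {N : ℕ} (α : Fin N → ℕ) (l : Fin N → ℂ) (t : Fin N → ℝ) : ℂ :=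
  ∏ i, ((t i : ℂ) ^ (α i) * cexp (l i * t i))

noncomputable def mD {N : ℕ} (t : Fin N → ℝ) : (Fin N → ℝ) →L[ℝ] (Fin N → ℝ) :=
  ContinuousLinearMap.pi fun i =>
    ((Real.exp (t i)) • ContinuousLinearMap.id ℝ ℝ).comp (ContinuousLinearMap.proj i)

lemma mE_hasFDerivAt {N : ℕ} (t : Fin N → ℝ) : HasFDerivAt mE (mD t) t := by
  rw [hasFDerivAt_pi']
  intro i
  have h := ((Real.hasDerivAt_exp (t i)).hasFDerivAt).comp t
    ((ContinuousLinearMap.proj (R := ℝ) (φ := fun _ : Fin N => ℝ) i).hasFDerivAt (x := t))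
  refine h.congr_fderiv ?_
  ext v
  simp [mD, mul_comm]

lemma mD_det {N : ℕ} (t : Fin N → ℝ) : (mD t).det = ∏ i, Real.exp (t i) := by
  simp only [mD]
  rw [ContinuousLinearMap.det_pi]
  refine Finset.prod_congr rfl fun i _ => ?_
  simp [ContinuousLinearMap.det]

lemma mE_inj {N : ℕ} : Function.Injective (mE (N := N)) := by
  intro s t h
  funext i
  exact Real.exp_injective (congrFun h i)

lemma mE_range {N : ℕ} :
    (mE (N := N)) '' Set.univ = Set.univ.pi fun _ : Fin N => Set.Ioi (0 : ℝ) := by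
  ext x
  simp only [Set.image_univ, Set.mem_range, Set.mem_pi, Set.mem_univ, true_imp_iff, Set.mem_Ioi]
  constructor
  · rintro ⟨t, rfl⟩ i
    exact Real.exp_pos _
  · intro h
    exact ⟨fun i => Real.log (x i), funext fun i => Real.exp_log (h i)⟩

lemma integrand_eq {N : ℕ} (Φ : (Fin N → ℝ) → ℂ) (α : Fin N → ℕ) (l : Fin N → ℂ)
    (t : Fin N → ℝ) :
    |(mD t).det| • (Φ (mE t) *
      ∏ i, ((Real.log (mE t i) : ℂ) ^ (α i) * ((mE t i : ℝ) : ℂ) ^ (l i - 1)))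
      = Φ (mE t) * mG α l t := by
  rw [mD_det, abs_of_pos (Finset.prod_pos fun i _ => Real.exp_pos _), Complex.real_smul,
    mul_left_comm]
  congr 1
  rw [Complex.ofReal_prod, ← Finset.prod_mul_distrib, mG]
  refine Finset.prod_congr rfl fun i _ => ?_
  rw [mE, Real.log_exp, mul_left_comm]
  congr 1
  rw [Complex.cpow_def_of_ne_zero (by simp [Complex.exp_ne_zero]), ← Complex.ofReal_log
    (Real.exp_pos _).le, Real.log_exp, Complex.ofReal_exp, ← Complex.exp_add]
  congr 1
  ring

lemma integral_subst {N : ℕ} (Φ : (Fin N → ℝ) → ℂ) (α : Fin N → ℕ) (l : Fin N → ℂ) :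
    ∫ x in Set.univ.pi fun _ : Fin N => Set.Ioi (0 : ℝ),
      Φ x * ∏ i, ((Real.log (x i) : ℂ) ^ (α i) * (x i : ℂ) ^ (l i - 1))
      = ∫ t, Φ (mE t) * mG α l t := by
  rw [← mE_range, integral_image_eq_integral_abs_det_fderiv_smul volume MeasurableSet.univ
    (fun t _ => (mE_hasFDerivAt t).hasFDerivWithinAt) mE_inj.injOn]
  simp_rw [integrand_eq]
  simp

lemma integrable_subst {N : ℕ} (Φ : (Fin N → ℝ) → ℂ) (α : Fin N → ℕ) (l : Fin N → ℂ) :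
    IntegrableOn (fun x => Φ x * ∏ i, ((Real.log (x i) : ℂ) ^ (α i) * (x i : ℂ) ^ (l i - 1)))
      (Set.univ.pi fun _ : Fin N => Set.Ioi (0 : ℝ))
      ↔ Integrable fun t => Φ (mE t) * mG α l t := by
  rw [← mE_range, integrableOn_image_iff_integrableOn_abs_det_fderiv_smul volume MeasurableSet.univ
    (fun t _ => (mE_hasFDerivAt t).hasFDerivWithinAt) mE_inj.injOn]
  simp_rw [integrand_eq]
  simp

/-- The dominating function. -/
noncomputable def mB {N : ℕ} (c : ℝ) (t : Fin N → ℝ) : ℝ := ∏ i, Real.exp (-c * |t i|)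

lemma mB_integrable {N : ℕ} {c : ℝ} (hc : 0 < c) : Integrable (mB (N := N) c) := by
  have h1 : Integrable (fun s : ℝ => Real.exp (-c * |s|)) := by
    rw [← integrableOn_univ, ← Set.Iic_union_Ioi (a := (0 : ℝ)), integrableOn_union]
    constructor
    · refine (integrableOn_exp_mul_Iic hc 0).congr_fun (fun s hs => ?_) measurableSet_Iic
      simp only [Set.mem_Iic] at hs
      simp [abs_of_nonpos hs]
    · refine (integrableOn_exp_mul_Ioi (neg_lt_zero.2 hc) 0).congr_fun (fun s hs => ?_)
        measurableSet_Ioi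
      simp only [Set.mem_Ioi] at hs
      simp [abs_of_pos hs]
  exact Integrable.fintype_prod (f := fun _ : Fin N => fun s : ℝ => Real.exp (-c * |s|))
    (fun _ => h1)

lemma norm_mG {N : ℕ} (α : Fin N → ℕ) (l : Fin N → ℂ) (t : Fin N → ℝ) :
    ‖mG α l t‖ = ∏ i, (|t i| ^ (α i) * Real.exp ((l i).re * t i)) := by
  simp [mG, norm_prod, Complex.norm_exp]

lemma pow_mul_exp_le {c : ℝ} (hc : 0 < c) (a : ℕ) (s : ℝ) (hs : 0 ≤ s) :
    s ^ a ≤ (a.factorial / c ^ a) * Real.exp (c * s) := by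
  have h := Real.pow_div_factorial_le_exp (c * s) (by positivity) a
  rw [div_le_iff₀ (by positivity), mul_pow] at h
  rw [div_mul_eq_mul_div, le_div_iff₀ (by positivity)]
  linarith

lemma key_bound {N : ℕ} (P : Set (Fin N)) (S : Set (Fin N → ℝ))
    (hS : ∃ T, 0 ≤ T ∧ ∀ t : Fin N → ℝ, mE t ∈ S → ∀ i ∉ P, |t i| ≤ T)
    (K : Set (Fin N → ℝ)) (hK : IsCompact K) (hKP : ∀ y ∈ K, ∀ i ∈ P, 0 < y i) :
    ∃ c > 0, ∀ (Φ : SchwartzMap (Fin N → ℝ) ℂ), tsupport Φ ⊆ S → ∀ α : Fin N → ℕ,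
      ∃ C > 0, ∀ l : Fin N → ℂ, (fun i => (l i).re) ∈ K → ∀ t,
        ‖Φ (mE t) * mG α l t‖ ≤ C * mB c t := by
  obtain ⟨T, hT0, hT⟩ := hS
  obtain ⟨M, hM⟩ := hK.isBounded.exists_norm_le
  have hδ : ∃ δ, 0 < δ ∧ δ ≤ 1 ∧ ∀ i ∈ P, ∀ y ∈ K, δ ≤ y i := by
    have h1 : ∀ᶠ δ in nhdsWithin (0 : ℝ) (Set.Ioi 0), ∀ i, i ∈ P → ∀ y ∈ K, δ ≤ y i := by
      rw [Filter.eventually_all]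
      intro i
      by_cases hi : i ∈ P
      · rcases K.eq_empty_or_nonempty with rfl | hne
        · simp
        obtain ⟨y0, hy0, hmin⟩ := hK.exists_isMinOn hne (continuous_apply i).continuousOn
        filter_upwards [nhdsWithin_le_nhds (Iio_mem_nhds (hKP y0 hy0 i hi))] with δ hδ _ y hy
        exact (le_of_lt hδ).trans (hmin hy)
      · simp [hi]
    have h2 : ∀ᶠ δ in nhdsWithin (0 : ℝ) (Set.Ioi 0), δ < 1 :=
      nhdsWithin_le_nhds (Iio_mem_nhds one_pos)
    have h3 : ∀ᶠ δ in nhdsWithin (0 : ℝ) (Set.Ioi 0), 0 < δ := self_mem_nhdsWithin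
    obtain ⟨δ, a, b, d⟩ := (h1.and (h2.and h3)).exists
    exact ⟨δ, d, b.le, a⟩
  obtain ⟨δ, hδ0, hδ1, hδ⟩ := hδ
  obtain ⟨R, hR⟩ := exists_nat_ge (|M| + 1)
  refine ⟨δ / 2, by positivity, fun Φ hΦ α => ?_⟩
  -- Schwartz bound
  obtain ⟨C1, hC1p, hC1⟩ : ∃ C1 > 0, ∀ x, (1 + ‖x‖) ^ (R * N) * ‖Φ x‖ ≤ C1 := by
    refine ⟨max 1 (2 ^ (R * N) * (Finset.Iic (R * N, 0)).sup
      (fun m => SchwartzMap.seminorm ℝ m.1 m.2) Φ), lt_of_lt_of_le one_pos (le_max_left _ _), fun x => le_max_of_le_right ?_⟩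
    have := SchwartzMap.one_add_le_sup_seminorm_apply (𝕜 := ℝ) (m := (R * N, 0)) le_rfl le_rfl Φ x
    simpa using this
  set A := (|M| + 1) * T with hA
  have hA0 : 0 ≤ A := by positivity
  let D : ℝ := ∏ i, (((α i).factorial / (δ / 2) ^ (α i)) * Real.exp A)
  have hD : 0 < D := Finset.prod_pos fun i _ => by positivity
  refine ⟨C1 * D, by positivity, fun l hl t => ?_⟩
  by_cases h0 : Φ (mE t) = 0
  · rw [h0]
    have : 0 ≤ mB (δ / 2) t := Finset.prod_nonneg fun i _ => (Real.exp_pos _).le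
    simp only [zero_mul, norm_zero]
    positivity
  have htS : mE t ∈ S := hΦ (subset_tsupport _ h0)
  have hfac : ∀ i, |t i| ^ (α i) * Real.exp ((l i).re * t i) ≤
      (((α i).factorial / (δ / 2) ^ (α i)) * Real.exp A) * Real.exp (-(δ / 2) * |t i|)
        * (1 + ‖mE t‖) ^ R := by
    intro i
    have hyM : |(l i).re| ≤ |M| := by
      have := (norm_le_pi_norm (fun i => (l i).re) i).trans (hM _ hl)
      exact this.trans (le_abs_self _)
    have hexp : (l i).re * t i ≤ A - δ * |t i| + R * max (t i) 0 := by
      have hub : (l i).re * t i ≤ |M| * |t i| :=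
        (le_abs_self _).trans (by rw [abs_mul]; gcongr)
      have hmx : 0 ≤ (R : ℝ) * max (t i) 0 := by positivity
      have hM0 := abs_nonneg M
      have ht0 := abs_nonneg (t i)
      by_cases hi : i ∈ P
      · rcases le_total 0 (t i) with h | h
        · rw [max_eq_left h, abs_of_nonneg h] at *
          nlinarith
        · have := hδ i hi _ hl
          rw [abs_of_nonpos h] at *
          nlinarith
      · have h1 := hT t htS i hi
        have : (|M| + 1) * |t i| ≤ A := by rw [hA]; gcongr
        nlinarith
    have hmaxexp : Real.exp (R * max (t i) 0) ≤ (1 + ‖mE t‖) ^ R := by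
      rw [Real.exp_nat_mul]
      gcongr
      rcases le_total 0 (t i) with h | h
      · rw [max_eq_left h]
        have := norm_le_pi_norm (mE t) i
        have h2 : ‖mE t i‖ = Real.exp (t i) := by simp [mE]
        linarith
      · rw [max_eq_right h, Real.exp_zero]
        have := norm_nonneg (mE t)
        linarith
    calc |t i| ^ (α i) * Real.exp ((l i).re * t i)
        ≤ (((α i).factorial / (δ / 2) ^ (α i)) * Real.exp ((δ / 2) * |t i|)) *
            Real.exp (A - δ * |t i| + R * max (t i) 0) := by
          gcongr
          exact pow_mul_exp_le (by positivity) _ _ (abs_nonneg _)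
      _ = (((α i).factorial / (δ / 2) ^ (α i)) * Real.exp A) * Real.exp (-(δ / 2) * |t i|)
            * Real.exp (R * max (t i) 0) := by
          have : Real.exp ((δ / 2) * |t i|) * Real.exp (A - δ * |t i| + R * max (t i) 0) =
            Real.exp A * Real.exp (-(δ / 2) * |t i|) * Real.exp (R * max (t i) 0) := by
            rw [← Real.exp_add, ← Real.exp_add, ← Real.exp_add]
            congr 1
            ring
          linear_combination ((α i).factorial / (δ / 2) ^ (α i)) * this
      _ ≤ _ := by gcongr
  rw [norm_mul, norm_mG]
  have hprod := Finset.prod_le_prod (s := Finset.univ) (fun i _ => by positivity)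
    (fun i _ => hfac i)
  have hR : ∏ i, ((((α i).factorial / (δ / 2) ^ (α i)) * Real.exp A) *
      Real.exp (-(δ / 2) * |t i|) * (1 + ‖mE t‖) ^ R) =
      D * mB (δ / 2) t * (1 + ‖mE t‖) ^ (R * N) := by
    rw [Finset.prod_mul_distrib, Finset.prod_mul_distrib, Finset.prod_const, Finset.card_univ,
      Fintype.card_fin, ← pow_mul]
    rfl
  rw [hR] at hprod
  have hB : 0 ≤ mB (δ / 2) t := Finset.prod_nonneg fun i _ => (Real.exp_pos _).le
  calc ‖Φ (mE t)‖ * ∏ i, (|t i| ^ (α i) * Real.exp ((l i).re * t i))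
      ≤ ‖Φ (mE t)‖ * (D * mB (δ / 2) t * (1 + ‖mE t‖) ^ (R * N)) := by gcongr
    _ = ((1 + ‖mE t‖) ^ (R * N) * ‖Φ (mE t)‖) * (D * mB (δ / 2) t) := by ring
    _ ≤ C1 * (D * mB (δ / 2) t) := by gcongr; exact hC1 _
    _ = _ := by ring

lemma mE_continuous {N : ℕ} : Continuous (mE (N := N)) := by
  unfold mE; fun_prop

lemma integrand_continuous {N : ℕ} (Φ : SchwartzMap (Fin N → ℝ) ℂ) (α : Fin N → ℕ)
    (l : Fin N → ℂ) : Continuous fun t => Φ (mE t) * mG α l t := by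
  refine (Φ.continuous.comp mE_continuous).mul ?_
  unfold mG; fun_prop

lemma integrand_integrable {N : ℕ} (P : Set (Fin N)) (S : Set (Fin N → ℝ))
    (hS : ∃ T, 0 ≤ T ∧ ∀ t : Fin N → ℝ, mE t ∈ S → ∀ i ∉ P, |t i| ≤ T)
    (Φ : SchwartzMap (Fin N → ℝ) ℂ) (hΦ : tsupport Φ ⊆ S) (α : Fin N → ℕ)
    (l : Fin N → ℂ) (hl : ∀ i ∈ P, 0 < (l i).re) :
    Integrable fun t => Φ (mE t) * mG α l t := by
  obtain ⟨c, hc, h⟩ := key_bound P S hS {fun i => (l i).re} isCompact_singleton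
    (by rintro y rfl; exact hl)
  obtain ⟨C, hC, hb⟩ := h Φ hΦ α
  exact ((mB_integrable hc).const_mul C).mono' (integrand_continuous Φ α l).aestronglyMeasurable
    (Filter.Eventually.of_forall (hb l rfl))

/-- The Euler operator. -/
noncomputable def theta {N : ℕ} (i : Fin N) (Φ : SchwartzMap (Fin N → ℝ) ℂ) :
    SchwartzMap (Fin N → ℝ) ℂ :=
  SchwartzMap.smulLeftCLM ℂ (fun x : Fin N → ℝ => x i)
    (LineDeriv.lineDerivOp (Pi.single i (1 : ℝ) : Fin N → ℝ) Φ)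

lemma theta_tsupport {N : ℕ} (i : Fin N) (Φ : SchwartzMap (Fin N → ℝ) ℂ) :
    tsupport (theta i Φ) ⊆ tsupport Φ :=
  (SchwartzMap.tsupport_smulLeftCLM_subset _ _).trans
    (Set.inter_subset_left.trans (SchwartzMap.tsupport_lineDerivOp_subset _ _))

lemma theta_apply {N : ℕ} (i : Fin N) (Φ : SchwartzMap (Fin N → ℝ) ℂ) (x : Fin N → ℝ) :
    theta i Φ x = x i • fderiv ℝ Φ x (Pi.single i 1) := by
  have : (fun x : Fin N → ℝ => x i).HasTemperateGrowth :=
    (ContinuousLinearMap.proj (R := ℝ) (φ := fun _ : Fin N => ℝ) i).hasTemperateGrowth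
  rw [theta, SchwartzMap.smulLeftCLM_apply_apply this, SchwartzMap.lineDerivOp_apply_eq_fderiv]

lemma comp_lineDeriv {N : ℕ} (i : Fin N) (Φ : SchwartzMap (Fin N → ℝ) ℂ) (t : Fin N → ℝ) :
    HasLineDerivAt ℝ (fun t => Φ (mE t)) (theta i Φ (mE t)) t (Pi.single i 1) := by
  have h := (Φ.differentiableAt (x := mE t)).hasFDerivAt.comp t (mE_hasFDerivAt t)
  have h2 := h.hasLineDerivAt (Pi.single i 1)
  convert! h2 using 1
  rw [theta_apply, ContinuousLinearMap.comp_apply, ← map_smul]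
  congr 1
  ext k
  by_cases hk : k = i
  · subst hk; simp [mD, mE]
  · simp [mD, mE, hk]

lemma mG_lineDeriv {N : ℕ} (i : Fin N) (α : Fin N → ℕ) (l : Fin N → ℂ) (t : Fin N → ℝ) :
    HasLineDerivAt ℝ (mG α l)
      (l i * mG α l t + (α i : ℂ) * mG (Function.update α i (α i - 1)) l t) t (Pi.single i 1) := by
  unfold HasLineDerivAt
  set Q : ℂ := ∏ k ∈ Finset.univ.erase i, ((t k : ℂ) ^ (α k) * cexp (l k * t k)) with hQ
  have e1 : ∀ s : ℝ, mG α l (t + s • Pi.single i 1) =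
      (((t i + s : ℝ) : ℂ) ^ (α i) * cexp (l i * ((t i + s : ℝ) : ℂ))) * Q := by
    intro s
    rw [mG, ← Finset.mul_prod_erase _ _ (Finset.mem_univ i)]
    congr 1
    · simp
    · refine Finset.prod_congr rfl fun k hk => ?_
      simp [Finset.ne_of_mem_erase hk]
  have e2 : mG (Function.update α i (α i - 1)) l t =
      ((t i : ℂ) ^ (α i - 1) * cexp (l i * t i)) * Q := by
    rw [mG, ← Finset.mul_prod_erase _ _ (Finset.mem_univ i)]
    congr 1
    · simp
    · refine Finset.prod_congr rfl fun k hk => ?_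
      simp [Finset.ne_of_mem_erase hk]
  have e0 : mG α l t = ((t i : ℂ) ^ (α i) * cexp (l i * t i)) * Q := by
    have := e1 0
    simpa using this
  rw [e2, e0]
  have hfun : (fun s : ℝ => mG α l (t + s • Pi.single i 1)) = fun s : ℝ =>
      (((t i + s : ℝ) : ℂ) ^ (α i) * cexp (l i * ((t i + s : ℝ) : ℂ))) * Q := funext e1
  rw [hfun]
  have hb : HasDerivAt (fun s : ℝ => ((t i + s : ℝ) : ℂ)) 1 0 := by
    have := ((hasDerivAt_id (0 : ℝ)).const_add (t i)).ofReal_comp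
    simpa using this
  have hp := hb.pow (α i)
  have hx := (hb.const_mul (l i)).cexp
  have := (hp.mul hx).mul_const Q
  convert! this using 1
  simp
  ring

lemma ibp {N : ℕ} (P : Set (Fin N)) (S : Set (Fin N → ℝ))
    (hS : ∃ T, 0 ≤ T ∧ ∀ t : Fin N → ℝ, mE t ∈ S → ∀ i ∉ P, |t i| ≤ T)
    (Φ : SchwartzMap (Fin N → ℝ) ℂ) (hΦ : tsupport Φ ⊆ S) (α : Fin N → ℕ)
    (l : Fin N → ℂ) (hl : ∀ i ∈ P, 0 < (l i).re) (i : Fin N) :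
    l i * ∫ t, Φ (mE t) * mG α l t =
      - (∫ t, theta i Φ (mE t) * mG α l t) -
        (α i : ℂ) * ∫ t, Φ (mE t) * mG (Function.update α i (α i - 1)) l t := by
  have I1 := integrand_integrable P S hS (theta i Φ) ((theta_tsupport i Φ).trans hΦ) α l hl
  have I2 := integrand_integrable P S hS Φ hΦ α l hl
  have I3 := integrand_integrable P S hS Φ hΦ (Function.update α i (α i - 1)) l hl
  have e : ∀ t, Φ (mE t) * (l i * mG α l t + (α i : ℂ) * mG (Function.update α i (α i - 1)) l t)
      = l i * (Φ (mE t) * mG α l t) +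
        (α i : ℂ) * (Φ (mE t) * mG (Function.update α i (α i - 1)) l t) := fun t => by ring
  have h := integral_bilinear_hasLineDerivAt_right_eq_neg_left_of_integrable
    (μ := (volume : Measure (Fin N → ℝ)))
    (f := fun t => Φ (mE t)) (f' := fun t => theta i Φ (mE t)) (g := mG α l)
    (g' := fun t => l i * mG α l t + (α i : ℂ) * mG (Function.update α i (α i - 1)) l t)
    (v := Pi.single i 1) (B := ContinuousLinearMap.mul ℝ ℂ)
    (by simpa using I1)
    (by
      simp only [ContinuousLinearMap.mul_apply', e]
      exact (I2.const_mul _).add (I3.const_mul _))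
    (by simpa using I2)
    (fun t _ => comp_lineDeriv i Φ t) (fun t _ => mG_lineDeriv i α l t)
  simp only [ContinuousLinearMap.mul_apply', e] at h
  rw [integral_add (I2.const_mul _) (I3.const_mul _), integral_const_mul, integral_const_mul] at h
  linear_combination h

lemma euclid_le {N : ℕ} (l : Fin N → ℂ) : euclideanNormC l ≤ ∑ i, ‖l i‖ := by
  unfold euclideanNormC
  rw [Real.sqrt_le_left (by positivity)]
  exact Finset.sum_sq_le_sq_sum_of_nonneg fun i _ => norm_nonneg _

lemma decay {N : ℕ} (P : Set (Fin N)) (S : Set (Fin N → ℝ))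
    (hS : ∃ T, 0 ≤ T ∧ ∀ t : Fin N → ℝ, mE t ∈ S → ∀ i ∉ P, |t i| ≤ T)
    (K : Set (Fin N → ℝ)) (hK : IsCompact K) (hKP : ∀ y ∈ K, ∀ i ∈ P, 0 < y i) (n : ℕ) :
    ∀ (Φ : SchwartzMap (Fin N → ℝ) ℂ), tsupport Φ ⊆ S → ∀ α : Fin N → ℕ,
      ∃ C > 0, ∀ l : Fin N → ℂ, (fun i => (l i).re) ∈ K →
        (euclideanNormC l + 1) ^ n * ‖∫ t, Φ (mE t) * mG α l t‖ ≤ C := by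
  induction n with
  | zero =>
    intro Φ hΦ α
    obtain ⟨c, hc, h⟩ := key_bound P S hS K hK hKP
    obtain ⟨C, hC, hb⟩ := h Φ hΦ α
    refine ⟨max 1 (∫ t : Fin N → ℝ, C * mB c t), lt_of_lt_of_le one_pos (le_max_left _ _),
      fun l hl => le_max_of_le_right ?_⟩
    rw [pow_zero, one_mul]
    exact norm_integral_le_of_norm_le ((mB_integrable hc).const_mul C)
      (Filter.Eventually.of_forall (hb l hl))
  | succ n ih =>
    intro Φ hΦ α
    obtain ⟨C0, hC0, h0⟩ := ih Φ hΦ α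
    choose C1 hC1 h1 using fun i => ih (theta i Φ) ((theta_tsupport i Φ).trans hΦ) α
    choose C2 hC2 h2 using fun i => ih Φ hΦ (Function.update α i (α i - 1))
    have hsum : 0 ≤ ∑ i, (C1 i + α i * C2 i) := Finset.sum_nonneg fun i _ => by
      have := hC1 i
      have := hC2 i
      positivity
    refine ⟨C0 + ∑ i, (C1 i + α i * C2 i), by positivity, fun l hl => ?_⟩
    set J := ∫ t, Φ (mE t) * mG α l t with hJ
    set E := euclideanNormC l with hE
    have hE0 : 0 ≤ E := Real.sqrt_nonneg _
    have hstep : ∀ i, (E + 1) ^ n * (‖l i‖ * ‖J‖) ≤ C1 i + α i * C2 i := by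
      intro i
      rw [← norm_mul, hJ, ibp P S hS Φ hΦ α l (hKP _ hl) i]
      have a := h1 i l hl
      have b := h2 i l hl
      rw [← hE] at a b
      calc _ ≤ (E + 1) ^ n * (‖∫ t, theta i Φ (mE t) * mG α l t‖ +
            α i * ‖∫ t, Φ (mE t) * mG (Function.update α i (α i - 1)) l t‖) := by
            gcongr
            refine (norm_sub_le _ _).trans ?_
            rw [norm_neg, norm_mul, Complex.norm_natCast]
        _ = (E + 1) ^ n * ‖∫ t, theta i Φ (mE t) * mG α l t‖ +
            α i * ((E + 1) ^ n *
              ‖∫ t, Φ (mE t) * mG (Function.update α i (α i - 1)) l t‖) := by ring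
        _ ≤ _ := by gcongr
    calc (E + 1) ^ (n + 1) * ‖J‖ = (E + 1) ^ n * ((E + 1) * ‖J‖) := by ring
      _ ≤ (E + 1) ^ n * ((∑ i, ‖l i‖ + 1) * ‖J‖) := by
          gcongr
          exact euclid_le l
      _ = (E + 1) ^ n * ‖J‖ + ∑ i, (E + 1) ^ n * (‖l i‖ * ‖J‖) := by
          rw [← Finset.mul_sum, ← Finset.sum_mul]; ring
      _ ≤ _ := add_le_add (h0 l hl) (Finset.sum_le_sum fun i _ => hstep i)

lemma mG_hasDerivAt {N : ℕ} (l : Fin N → ℂ) (i : Fin N) (t : Fin N → ℝ) (z : ℂ) :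
    HasDerivAt (fun z => mG 0 (Function.update l i z) t)
      (mG (Pi.single i 1) (Function.update l i z) t) z := by
  set Q : ℂ := ∏ k ∈ Finset.univ.erase i, cexp (l k * t k) with hQ
  have e1 : ∀ z, mG 0 (Function.update l i z) t = cexp (z * t i) * Q := by
    intro z
    rw [mG, ← Finset.mul_prod_erase _ _ (Finset.mem_univ i)]
    congr 1
    · simp
    · refine Finset.prod_congr rfl fun k hk => ?_
      simp [Finset.ne_of_mem_erase hk]
  have e2 : mG (Pi.single i 1) (Function.update l i z) t = (t i * cexp (z * t i)) * Q := by
    rw [mG, ← Finset.mul_prod_erase _ _ (Finset.mem_univ i)]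
    congr 1
    · simp
    · refine Finset.prod_congr rfl fun k hk => ?_
      simp [Finset.ne_of_mem_erase hk]
  rw [e2, funext e1]
  have := (((hasDerivAt_id z).mul_const (t i : ℂ)).cexp).mul_const Q
  convert! this using 1
  simp only [id]
  ring

lemma holo {N : ℕ} (P : Set (Fin N)) (S : Set (Fin N → ℝ))
    (hS : ∃ T, 0 ≤ T ∧ ∀ t : Fin N → ℝ, mE t ∈ S → ∀ i ∉ P, |t i| ≤ T)
    (Φ : SchwartzMap (Fin N → ℝ) ℂ) (hΦ : tsupport Φ ⊆ S)
    (l : Fin N → ℂ) (hl : ∀ i ∈ P, 0 < (l i).re) (i : Fin N) :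
    DifferentiableAt ℂ (fun z => ∫ t, Φ (mE t) * mG 0 (Function.update l i z) t) (l i) := by
  have hopen : IsOpen {y : Fin N → ℝ | ∀ i ∈ P, 0 < y i} := by
    simp only [Set.ofPred_forall]
    exact isOpen_iInter_of_finite fun i => isOpen_iInter_of_finite fun _ =>
      isOpen_lt continuous_const (continuous_apply i)
  obtain ⟨ε, hε, hball⟩ := Metric.nhds_basis_closedBall.mem_iff.1
    (hopen.mem_nhds (show (fun i => (l i).re) ∈ {y : Fin N → ℝ | ∀ i ∈ P, 0 < y i} from hl))
  obtain ⟨c, hc, h⟩ := key_bound P S hS _ (isCompact_closedBall (fun i => (l i).re) ε)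
    (fun y hy => hball hy)
  obtain ⟨C, hC, hb⟩ := h Φ hΦ (Pi.single i 1)
  have hI := integrand_integrable P S hS Φ hΦ 0 l hl
  refine (hasDerivAt_integral_of_dominated_loc_of_deriv_le (𝕜 := ℂ)
    (F' := fun z t => Φ (mE t) * mG (Pi.single i 1) (Function.update l i z) t)
    (bound := fun t => C * mB c t) (Metric.ball_mem_nhds (l i) hε)
    (Filter.Eventually.of_forall fun z => (integrand_continuous Φ _ _).aestronglyMeasurable)
    (by simpa using hI) (integrand_continuous Φ _ _).aestronglyMeasurable
    (Filter.Eventually.of_forall fun t z hz => hb _ ?_ t)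
    ((mB_integrable hc).const_mul C)
    (Filter.Eventually.of_forall fun t z hz =>
      (mG_hasDerivAt l i t z).const_mul _)).2.differentiableAt
  rw [Metric.mem_closedBall, dist_pi_le_iff hε.le]
  intro k
  by_cases hk : k = i
  · subst hk
    simp only [Function.update_self, Real.dist_eq, ← Complex.sub_re]
    rw [Metric.mem_ball, Complex.dist_eq] at hz
    exact (Complex.abs_re_le_norm _).trans hz.le
  · simp [hk, hε.le]

lemma compact_log_bound (j m : ℕ) (K₀ : Set (Fin j → ℝ)) (hc : IsCompact K₀)
    (hpos : K₀ ⊆ {y | ∀ i, 0 < y i}) :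
    ∃ T, 0 ≤ T ∧ ∀ t : Fin (j + m) → ℝ,
      mE t ∈ {x : Fin (j + m) → ℝ | (fun i : Fin j => x (Fin.castAdd m i)) ∈ K₀} →
      ∀ i ∉ Set.range (Fin.natAdd j : Fin m → Fin (j + m)), |t i| ≤ T := by
  have hcont : ContinuousOn (fun y : Fin j → ℝ => fun i => Real.log (y i)) K₀ := by
    refine continuousOn_pi.2 fun i => ContinuousOn.log (continuous_apply i).continuousOn ?_
    intro y hy
    exact (hpos hy i).ne'
  obtain ⟨T, hT⟩ := (hc.image_of_continuousOn hcont).isBounded.exists_norm_le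
  refine ⟨|T|, abs_nonneg _, fun t ht i hi => ?_⟩
  induction i using Fin.addCases with
  | left i =>
    have := (norm_le_pi_norm _ i).trans (hT _ ⟨_, ht, rfl⟩)
    simp only [mE, Real.log_exp, Real.norm_eq_abs] at this
    exact this.trans (le_abs_self _)
  | right i => exact absurd ⟨i, rfl⟩ hi

end MellinAux

/-- **Lemma 3.2 of the paper.**  Let `j + m ≥ 1` and let `Φ : ℝ^(j+m) → ℂ` be a
Schwartz function supported in `K₀ × ℝ^m` for a compact `K₀ ⊆ (0,∞)^j`.  For
`λ ∈ ℂ^(j+m)` with `Re λᵢ > 0` for the last `m` coordinates, the multivariate Mellin transform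
`Φ̃(λ) = ∫_{(0,∞)^(j+m)} Φ(x) ∏ᵢ xᵢ^(λᵢ-1) dx` converges absolutely, is holomorphic in each
variable, and for every compact `K ⊆ ℝ^j × (0,∞)^m`, multi-index `α`, and natural `n`, there
is `C > 0` with `(‖λ‖ + 1)^n * |∂^α Φ̃(λ)| ≤ C` whenever `Re λ ∈ K`, where
`∂^α Φ̃(λ) = ∫_{(0,∞)^(j+m)} Φ(x) ∏ᵢ (log xᵢ)^(αᵢ) xᵢ^(λᵢ-1) dx` and `‖λ‖` is the Euclidean
norm on `ℂ^(j+m)`. -/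
theorem multivariate_mellin_mixed_compact_schwartz_rapid_decay
    (j m : ℕ) (hjm : 1 ≤ j + m) (Φ : SchwartzMap (Fin (j + m) → ℝ) ℂ)
    (K₀ : Set (Fin j → ℝ)) (hK₀c : IsCompact K₀) (hK₀pos : K₀ ⊆ {y | ∀ i, 0 < y i})
    (hsupp : tsupport ⇑Φ ⊆ {x | (fun i : Fin j => x (Fin.castAdd m i)) ∈ K₀}) :
    (∀ l : Fin (j + m) → ℂ, (∀ i : Fin m, 0 < (l (Fin.natAdd j i)).re) →
      IntegrableOn
        (fun x => Φ x * ∏ i, (x i : ℂ) ^ (l i - 1))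
        (Set.univ.pi fun _ : Fin (j + m) => Set.Ioi (0 : ℝ)) ∧
      ∀ i₀ : Fin (j + m), DifferentiableAt ℂ
        (fun z : ℂ =>
          ∫ x in Set.univ.pi fun _ : Fin (j + m) => Set.Ioi (0 : ℝ),
            Φ x * ∏ i, (x i : ℂ) ^ (Function.update l i₀ z i - 1)) (l i₀)) ∧
    ∀ K : Set (Fin (j + m) → ℝ), IsCompact K →
      K ⊆ {y | ∀ i : Fin m, 0 < y (Fin.natAdd j i)} →
      ∀ α : Fin (j + m) → ℕ, ∀ n : ℕ, ∃ C > 0,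
        ∀ l : Fin (j + m) → ℂ, (fun i => (l i).re) ∈ K →
          (euclideanNormC l + 1) ^ n *
            ‖∫ x in Set.univ.pi fun _ : Fin (j + m) => Set.Ioi (0 : ℝ),
                Φ x * ∏ i, ((Real.log (x i) : ℂ) ^ (α i) * (x i : ℂ) ^ (l i - 1))‖ ≤ C := by
  have hS := MellinAux.compact_log_bound j m K₀ hK₀c hK₀pos
  refine ⟨fun l hl => ?_, fun K hK hKP α n => ?_⟩
  · have hl' : ∀ i ∈ Set.range (Fin.natAdd j : Fin m → Fin (j + m)), 0 < (l i).re := by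
      rintro _ ⟨i, rfl⟩
      exact hl i
    refine ⟨?_, fun i₀ => ?_⟩
    · have := (MellinAux.integrable_subst Φ 0 l).2
        (MellinAux.integrand_integrable _ _ hS Φ hsupp 0 l hl')
      simpa using this
    · have := MellinAux.holo _ _ hS Φ hsupp l hl' i₀
      simp_rw [← MellinAux.integral_subst] at this
      simpa using this
  · obtain ⟨C, hC, h⟩ := MellinAux.decay _ _ hS K hK
      (by rintro y hy _ ⟨i, rfl⟩; exact hKP hy i) n Φ hsupp α
    refine ⟨C, hC, fun l hl => ?_⟩
    rw [MellinAux.integral_subst]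
    exact h l hl
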